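/- Let m, n ∈ ℕ with m ≠ n and m, n ∉ {1, 2}. Then ∫_ℝ Wr[H_1, H_2, H_m](z) · Wr[H_1, H_2, H_n](z) · e^{−z²} / (4 + 8z²)² dz = 0; that is, the exceptional Hermite polynomials Ĥ_m, Ĥ_n proportional to these Wronskians are orthogonal with respect to the weight Ŵ(z) = e^{−z²}/η(z)², where η(z) = Wr[H_1,H_2](z) = 4 + 8z². -/

import Mathlib

open Polynomial

/-- The physicists' Hermite polynomials: `H₀ = 1`, `H_{n+1} = 2·X·H_n − (H_n)'`. -/
noncomputable def hermitePoly : ℕ → Polynomial ℝ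
  | 0 => 1
  | n + 1 => 2 * X * hermitePoly n - derivative (hermitePoly n)

/-- The Wronskian of `m` polynomials: the determinant of the `m × m` matrix whose `(i, j)` entry
is the `j`-th derivative of `p i`. -/
noncomputable def polyWronskian {m : ℕ} (p : Fin m → Polynomial ℝ) : Polynomial ℝ :=
  Matrix.det (Matrix.of fun i j : Fin m => (⇑(derivative (R := ℝ)))^[(j : ℕ)] (p i))

theorem derivative_hermitePoly_succ (n : ℕ) :
    derivative (hermitePoly (n + 1)) = 2 * ((n : ℝ[X]) + 1) * hermitePoly n := by
  induction n with
  | zero => simp [hermitePoly]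
  | succ n ih =>
    have h : derivative (derivative (hermitePoly (n + 1))) =
        2 * ((n : ℝ[X]) + 1) * derivative (hermitePoly n) := by
      rw [ih]; simp
    have h2 : hermitePoly (n + 1) = 2 * X * hermitePoly n - derivative (hermitePoly n) := rfl
    rw [show hermitePoly (n + 1 + 1) =
      2 * X * hermitePoly (n + 1) - derivative (hermitePoly (n + 1)) from rfl]
    simp only [derivative_sub, derivative_mul, derivative_X, derivative_ofNat, h]
    rw [ih, h2]
    push_cast
    ring

/-- The Hermite differential equation. -/
theorem derivative_derivative_hermitePoly (n : ℕ) :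
    derivative (derivative (hermitePoly n)) =
      2 * X * derivative (hermitePoly n) - 2 * (n : ℝ[X]) * hermitePoly n := by
  have h := derivative_hermitePoly_succ n
  rw [show hermitePoly (n + 1) = 2 * X * hermitePoly n - derivative (hermitePoly n) from rfl] at h
  simp only [derivative_sub, derivative_mul, derivative_X, derivative_ofNat] at h
  linear_combination -h

theorem polyWronskian_hermitePoly_one_two (p : ℝ[X]) :
    polyWronskian ![hermitePoly 1, hermitePoly 2, p] =
      16 * p - 16 * X * derivative p + (8 * X ^ 2 + 4) * derivative (derivative p) := by
  simp [polyWronskian, Matrix.det_fin_three, hermitePoly]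
  ring

/-- The differential equation of the exceptional Hermite polynomials, cleared of denominators. -/
theorem polyWronskian_hermitePoly_ode (n : ℕ) (W : ℝ[X])
    (hW : W = polyWronskian ![hermitePoly 1, hermitePoly 2, hermitePoly n]) :
    (4 + 8 * X ^ 2) * derivative (derivative W) =
      2 * (X * (4 + 8 * X ^ 2) + 16 * X) * derivative W - (16 + 32 * X ^ 2) * W
        + (4 - 2 * (n : ℝ[X])) * (4 + 8 * X ^ 2) * W := by
  have h := derivative_derivative_hermitePoly n
  rw [polyWronskian_hermitePoly_one_two, h] at hW
  subst hW
  simp only [derivative_sub, derivative_add, derivative_mul, derivative_X, derivative_X_pow,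
    derivative_ofNat, derivative_natCast, h, map_zero, derivative_one, pow_one,
    Nat.cast_ofNat, C_ofNat, Nat.reduceSub]
  ring

theorem integrable_eval_mul_exp_neg_sq (p : ℝ[X]) :
    MeasureTheory.Integrable fun z : ℝ => p.eval z * Real.exp (-z ^ 2) := by
  induction p using Polynomial.induction_on' with
  | add p q hp hq => simpa only [eval_add, add_mul] using! hp.add hq
  | monomial k a =>
    have h := integrable_rpow_mul_exp_neg_mul_sq (b := 1) one_pos (s := (k : ℝ))
      (lt_of_lt_of_le (by norm_num) k.cast_nonneg)
    simpa [mul_assoc] using h.const_mul a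

theorem integrable_eval_mul_exp_neg_sq_div (p : ℝ[X]) :
    MeasureTheory.Integrable fun z : ℝ =>
      p.eval z * Real.exp (-z ^ 2) / (4 + 8 * z ^ 2) ^ 2 := by
  refine (integrable_eval_mul_exp_neg_sq p).mono ?_ (.of_forall fun z => ?_)
  · refine Continuous.aestronglyMeasurable (Continuous.div ?_ (by fun_prop) fun z => by positivity)
    exact p.continuous.mul (by fun_prop)
  · rw [norm_div]
    refine div_le_self (norm_nonneg _) ?_
    rw [Real.norm_of_nonneg (by positivity)]
    nlinarith [sq_nonneg z]

/-- the exceptional Hermite polynomials (proportional to `Wr[H₁,H₂,H_n]`) are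
orthogonal with respect to the weight `Ŵ(z) = e^{−z²}/(4 + 8z²)²`. -/
theorem excHermite_orthogonality (m n : ℕ) (hmn : m ≠ n)
    (hm1 : m ≠ 1) (hm2 : m ≠ 2) (hn1 : n ≠ 1) (hn2 : n ≠ 2) :
    ∫ z : ℝ,
      (polyWronskian ![hermitePoly 1, hermitePoly 2, hermitePoly m]).eval z *
        (polyWronskian ![hermitePoly 1, hermitePoly 2, hermitePoly n]).eval z *
        Real.exp (-z ^ 2) / (4 + 8 * z ^ 2) ^ 2 = 0 := by
  generalize hP : polyWronskian ![hermitePoly 1, hermitePoly 2, hermitePoly m] = P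
  generalize hQ : polyWronskian ![hermitePoly 1, hermitePoly 2, hermitePoly n] = Q
  have hderiv : ∀ z : ℝ, HasDerivAt
      (fun z : ℝ => (derivative P * Q - P * derivative Q).eval z * Real.exp (-z ^ 2) /
        (4 + 8 * z ^ 2) ^ 2)
      (2 * ((n : ℝ) - m) *
        (P.eval z * Q.eval z * Real.exp (-z ^ 2) / (4 + 8 * z ^ 2) ^ 2)) z := by
    intro z
    have hPode := congrArg (eval z) (polyWronskian_hermitePoly_ode m P hP.symm)
    have hQode := congrArg (eval z) (polyWronskian_hermitePoly_ode n Q hQ.symm)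
    simp only [eval_add, eval_sub, eval_mul, eval_pow, eval_X, eval_ofNat, eval_natCast]
      at hPode hQode
    have hη : (4 + 8 * z ^ 2 : ℝ) ≠ 0 := by positivity
    have hexp : HasDerivAt (fun z : ℝ => Real.exp (-z ^ 2)) (Real.exp (-z ^ 2) * (-(2 * z))) z := by
      simpa using ((hasDerivAt_pow 2 z).neg).exp
    have hden : HasDerivAt (fun z : ℝ => (4 + 8 * z ^ 2) ^ 2)
        (2 * (4 + 8 * z ^ 2) * (16 * z)) z := by
      refine ((((hasDerivAt_pow 2 z).const_mul 8).const_add 4).fun_pow 2).congr_deriv ?_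
      push_cast
      ring
    have h := (((derivative P * Q - P * derivative Q).hasDerivAt z).mul hexp).div hden
      (pow_ne_zero 2 hη)
    refine h.congr_deriv ?_
    simp only [derivative_sub, derivative_mul, eval_add, eval_sub, eval_mul, Pi.mul_apply]
    field_simp
    linear_combination (Q.eval z) * hPode - (P.eval z) * hQode
  have h := MeasureTheory.integral_eq_zero_of_hasDerivAt_of_integrable hderiv
    (by simpa using (integrable_eval_mul_exp_neg_sq_div (P * Q)).const_mul (2 * ((n : ℝ) - m)))
    (integrable_eval_mul_exp_neg_sq_div _)
  rw [MeasureTheory.integral_const_mul] at h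
  refine (mul_eq_zero.mp h).resolve_left (mul_ne_zero two_ne_zero (sub_ne_zero.mpr ?_))
  exact_mod_cast hmn.symm
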